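/- arXiv:1409.1773 — 4 statements merged into one kernel-verified Lean document; each statement's English description precedes it below -/
import Mathlib

section
/- Let X_e be a complex Banach space, A_e a bounded linear operator on X_e, and ω ∈ ℝ such that iω − A_e is boundedly invertible with inverse R. Let n ≥ 1, let N be the n×n nilpotent Jordan shift matrix (N e_1 = 0 and N e_l = e_{l−1} for l = 2, …, n, where e_1, …, e_n is the standard basis of ℂ^n), let S = iω I + N, and let B_e : ℂ^n → X_e be a linear map. Then there exists exactly one linear map Σ : ℂ^n → X_e satisfying Σ S = A_e Σ + B_e, and it is given by Σ e_l = ∑_{j=1}^{l} (−1)^{l−j} R^{l+1−j} B_e e_j for l = 1, …, n. -/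
open scoped Matrix

/-- The recursive solution sequence. -/
def sylvSeq {X : Type*} [AddCommGroup X] (R : X → X) (b : ℕ → X) : ℕ → X
  | 0 => R (b 0)
  | k + 1 => R (b (k + 1) - sylvSeq R b k)

theorem sylvSeq_eq {X : Type*} [NormedAddCommGroup X] [NormedSpace ℂ X]
    (R : X →L[ℂ] X) (b : ℕ → X) (l : ℕ) :
    sylvSeq R b l =
      ∑ j ∈ Finset.range (l + 1), ((-1 : ℂ) ^ (l - j)) • (R ^ (l - j + 1)) (b j) := by
  induction l with
  | zero => simp [sylvSeq]
  | succ k ih =>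
    rw [Finset.sum_range_succ, sylvSeq, ih, map_sub, map_sum, sub_eq_add_neg, add_comm]
    congr 1
    · rw [← Finset.sum_neg_distrib]
      refine Finset.sum_congr rfl fun j hj => ?_
      have hj' : k + 1 - j = k - j + 1 := by
        have := Finset.mem_range.1 hj
        omega
      rw [hj', pow_succ' R (k - j + 1), map_smul, pow_succ (-1 : ℂ)]
      simp
    · simp

/-- Explicit solution formula for the Sylvester equation associated to a
single Jordan block `S = iω I + N` of the exosystem: if `iω − Aₑ` is boundedly invertible
with inverse `R`, then the Sylvester equation `Σ S = Aₑ Σ + Bₑ` has exactly one linear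
solution `Σ : ℂ^n → Xₑ`, and it is given by
`Σ e_l = ∑_{j ≤ l} (−1)^{l−j} R^{l+1−j} (Bₑ e_j)` (indices here zero-based). -/
theorem stmt_4 {Xe : Type*} [NormedAddCommGroup Xe] [NormedSpace ℂ Xe] [CompleteSpace Xe]
    (Ae : Xe →L[ℂ] Xe) (ω : ℝ) (R : Xe →L[ℂ] Xe)
    (hR1 : ∀ x : Xe, R ((Complex.I * ω) • x - Ae x) = x)
    (hR2 : ∀ x : Xe, (Complex.I * ω) • (R x) - Ae (R x) = x)
    (n : ℕ) (hn : 1 ≤ n)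
    (N : Matrix (Fin n) (Fin n) ℂ)
    (hN : ∀ i j : Fin n, N i j = if (i : ℕ) + 1 = (j : ℕ) then 1 else 0)
    (S : Matrix (Fin n) (Fin n) ℂ)
    (hS : S = (Complex.I * ω) • (1 : Matrix (Fin n) (Fin n) ℂ) + N)
    (Be : (Fin n → ℂ) →ₗ[ℂ] Xe) :
    (∃! Sig : (Fin n → ℂ) →ₗ[ℂ] Xe, ∀ v : Fin n → ℂ, Sig (S *ᵥ v) = Ae (Sig v) + Be v) ∧
    (∀ Sig : (Fin n → ℂ) →ₗ[ℂ] Xe, (∀ v : Fin n → ℂ, Sig (S *ᵥ v) = Ae (Sig v) + Be v) →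
      ∀ l : Fin n, Sig (Pi.single l 1) =
        ∑ j ∈ Finset.Iic l, ((-1 : ℂ) ^ ((l : ℕ) - (j : ℕ))) •
          (R ^ ((l : ℕ) - (j : ℕ) + 1)) (Be (Pi.single j 1))) := by
  set c : ℂ := Complex.I * ω with hc
  let b : ℕ → Xe := fun k => if h : k < n then Be (Pi.single ⟨k, h⟩ 1) else 0
  have hb : ∀ l : Fin n, b l = Be (Pi.single l 1) := fun l => by simp [b]
  have hS0 : ∀ h : 0 < n, S *ᵥ (Pi.single ⟨0, h⟩ 1) = c • Pi.single ⟨0, h⟩ 1 := by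
    intro h
    rw [hS, Matrix.add_mulVec, Matrix.smul_mulVec, Matrix.one_mulVec]
    ext i
    simp [hN]
  have hS1 : ∀ k (h : k + 1 < n), S *ᵥ (Pi.single ⟨k + 1, h⟩ 1) =
      c • Pi.single ⟨k + 1, h⟩ 1 + Pi.single ⟨k, Nat.lt_of_succ_lt h⟩ 1 := by
    intro k h
    rw [hS, Matrix.add_mulVec, Matrix.smul_mulVec, Matrix.one_mulVec]
    congr 1
    ext i
    simp [hN, Pi.single_apply, Fin.ext_iff]
  have key : ∀ Sig : (Fin n → ℂ) →ₗ[ℂ] Xe,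
      (∀ v : Fin n → ℂ, Sig (S *ᵥ v) = Ae (Sig v) + Be v) →
      ∀ k (h : k < n), Sig (Pi.single ⟨k, h⟩ 1) = sylvSeq R b k := by
    intro Sig hSig k
    induction k with
    | zero =>
      intro h
      have h1 := hSig (Pi.single ⟨0, h⟩ 1)
      rw [hS0, map_smul, ← hb] at h1
      rw [sylvSeq, ← hR1 (Sig _), h1]
      simp
    | succ k ih =>
      intro h
      have h1 := hSig (Pi.single ⟨k + 1, h⟩ 1)
      rw [hS1, map_add, map_smul, ← hb, ih] at h1
      rw [sylvSeq, ← hR1 (Sig _)]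
      congr 1
      rw [sub_eq_sub_iff_add_eq_add, h1, add_comm]
  refine ⟨⟨(Pi.basisFun ℂ (Fin n)).constr ℂ (fun l => sylvSeq R b l), ?_, ?_⟩, ?_⟩
  · set Sig := (Pi.basisFun ℂ (Fin n)).constr ℂ (fun l : Fin n => sylvSeq R b l) with hSigd
    have hv : ∀ l : Fin n, Sig (Pi.single l 1) = sylvSeq R b l := by
      intro l
      rw [← Pi.basisFun_apply, hSigd, Module.Basis.constr_basis]
    have hlin : Sig ∘ₗ S.mulVecLin = Ae.toLinearMap ∘ₗ Sig + Be := by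
      refine (Pi.basisFun ℂ (Fin n)).ext fun l => ?_
      obtain ⟨k, h⟩ := l
      simp only [Pi.basisFun_apply, LinearMap.comp_apply, LinearMap.add_apply,
        Matrix.mulVecLin_apply, ContinuousLinearMap.coe_coe]
      cases k with
      | zero =>
        rw [hS0, map_smul, hv, ← hb]
        have := hR2 (b 0)
        exact sub_eq_iff_eq_add'.1 this
      | succ k =>
        rw [hS1, map_add, map_smul, hv, hv, ← hb]
        have := hR2 (b (k + 1) - sylvSeq R b k)
        have h2 := sub_eq_iff_eq_add'.1 this
        simp only [sylvSeq]
        rw [h2]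
        abel
    intro v
    exact LinearMap.congr_fun hlin v
  · intro Sig hSig
    refine (Pi.basisFun ℂ (Fin n)).ext fun l => ?_
    rw [Module.Basis.constr_basis, Pi.basisFun_apply]
    exact key Sig hSig l l.2
  · intro Sig hSig l
    rw [key Sig hSig l l.2, sylvSeq_eq]
    symm
    refine Finset.sum_bij (fun j _ => (j : ℕ)) ?_ ?_ ?_ ?_
    · intro j hj
      have := Finset.mem_Iic.1 hj
      rw [Fin.le_def] at this
      simp
      omega
    · intro a _ a' _ h
      exact Fin.ext h
    · intro j hj
      have := Finset.mem_range.1 hj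
      refine ⟨⟨j, by omega⟩, ?_, rfl⟩
      rw [Finset.mem_Iic, Fin.le_def]
      simp
      omega
    · intro j _
      rw [hb]
end

section
/- Let Z, U, Y be complex vector spaces, D ⊆ Z a subspace, G : D → Z and K : D → U linear maps, ω ∈ ℝ, n ≥ 1, and P_0, P_1, …, P_{n−1} : U → Y linear maps. Assume that every z ∈ D with G z = iω z and P_0(K z) = 0 is zero. Then every tuple z⃗ = (z_n, …, z_1) ∈ D^n satisfying J_n z⃗ = 0 and ℙ(K z_n, …, K z_1) = 0 is the zero tuple. -/
/-- If the restriction of `P₀ ∘ K` to the eigenspace `ker(iω − G)` is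
injective, then the block upper-triangular Toeplitz operator `ℙ ∘ K` is injective on the
kernel of the Jordan operator `J_n(ω, G)`.  Tuples are indexed zero-based: `z l`
corresponds to `z_{l+1}` of the natural-language statement. -/
theorem stmt_5 {Z U Y : Type*} [AddCommGroup Z] [Module ℂ Z]
    [AddCommGroup U] [Module ℂ U] [AddCommGroup Y] [Module ℂ Y]
    (D : Submodule ℂ Z) (G : D →ₗ[ℂ] Z) (K : D →ₗ[ℂ] U)
    (ω : ℝ) (n : ℕ) (hn : 1 ≤ n) (P : ℕ → U →ₗ[ℂ] Y)
    (hinj : ∀ w : D, G w = (Complex.I * ω) • (w : Z) → P 0 (K w) = 0 → w = 0) :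
    ∀ z : ℕ → D,
      G (z 0) = (Complex.I * ω) • ((z 0 : Z)) →
      (∀ l : ℕ, 1 ≤ l → l < n →
        G (z l) - (Complex.I * ω) • ((z l : Z)) = ((z (l - 1) : Z))) →
      (∀ m : ℕ, m < n → ∑ j ∈ Finset.range (m + 1), P j (K (z (m - j))) = 0) →
      ∀ l : ℕ, l < n → z l = 0 := by
  intro z h0 hJ hP l
  induction l using Nat.strong_induction_on with
  | _ l ih =>
    intro hl
    apply hinj
    · rcases Nat.eq_zero_or_pos l with h | h
      · rw [h]; exact h0
      · have h1 := hJ l h hl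
        rw [ih (l - 1) (by omega) (by omega)] at h1
        exact sub_eq_zero.mp (by simpa using h1)
    · have h1 := hP l hl
      rw [Finset.sum_eq_single 0] at h1
      · simpa using h1
      · intro j hj hj0
        have hj' := Finset.mem_range.mp hj
        rw [ih (l - j) (by omega) (by omega)]
        simp
      · intro h
        simp at h
end

section
/- Let Z, U, Y be complex vector spaces with Y finite-dimensional of dimension p, let D ⊆ Z be a subspace, G : D → Z and K : D → U linear maps, ω ∈ ℝ, n ≥ 1, and P_0, P_1, …, P_{n−1} : U → Y linear maps. Assume that for every y⃗ ∈ Y^n there exists z⃗ = (z_n, …, z_1) ∈ D^n with J_n z⃗ = 0 and ℙ(K z_n, …, K z_1) = y⃗. Then there exist vectors z_j^l ∈ D for l = 1, …, p and j = 1, …, n such that for each l the tuple (z_j^l)_{j=1}^n is a Jordan chain of G at iω of length n (i.e., G z_1^l = iω z_1^l and (G − iω) z_j^l = z_{j−1}^l for j = 2, …, n), and the eigenvectors z_1^1, …, z_1^p are linearly independent. -/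
/-- If the block upper-triangular Toeplitz operator `ℙ ∘ K` restricted to
the kernel of the Jordan operator `J_n(ω, G)` is surjective onto `Y^n` with
`dim Y = p`, then `G` has `p` independent Jordan chains of length `n` at `iω`.
Chains are indexed zero-based: `z l j` corresponds to `z_{j+1}^{l+1}`. -/
theorem stmt_6 {Z U Y : Type*} [AddCommGroup Z] [Module ℂ Z]
    [AddCommGroup U] [Module ℂ U] [AddCommGroup Y] [Module ℂ Y]
    [FiniteDimensional ℂ Y] (p : ℕ) (hp : Module.finrank ℂ Y = p)
    (D : Submodule ℂ Z) (G : D →ₗ[ℂ] Z) (K : D →ₗ[ℂ] U)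
    (ω : ℝ) (n : ℕ) (hn : 1 ≤ n) (P : ℕ → U →ₗ[ℂ] Y)
    (hsurj : ∀ y : ℕ → Y, ∃ z : ℕ → D,
      (G (z 0) = (Complex.I * ω) • ((z 0 : Z))) ∧
      (∀ l : ℕ, 1 ≤ l → l < n →
        G (z l) - (Complex.I * ω) • ((z l : Z)) = ((z (l - 1) : Z))) ∧
      (∀ m : ℕ, m < n → ∑ j ∈ Finset.range (m + 1), P j (K (z (m - j))) = y m)) :
    ∃ z : Fin p → ℕ → D,
      (∀ l : Fin p,
        G (z l 0) = (Complex.I * ω) • ((z l 0 : Z)) ∧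
        ∀ j : ℕ, 1 ≤ j → j < n →
          G (z l j) - (Complex.I * ω) • ((z l j : Z)) = ((z l (j - 1) : Z))) ∧
      LinearIndependent ℂ (fun l : Fin p => ((z l 0 : Z))) := by
  let b := Module.finBasisOfFinrankEq ℂ Y hp
  choose z h0 h1 h2 using fun l : Fin p => hsurj (fun _ => b l)
  refine ⟨z, fun l => ⟨h0 l, h1 l⟩, ?_⟩
  have hb : ∀ l, (P 0 ∘ₗ K) (z l 0) = b l := fun l => by
    simpa using h2 l 0 hn
  have hD : LinearIndependent ℂ (fun l : Fin p => z l 0) := by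
    apply LinearIndependent.of_comp (P 0 ∘ₗ K)
    have : (⇑(P 0 ∘ₗ K) ∘ fun l : Fin p => z l 0) = b := funext hb
    rw [this]
    exact b.linearIndependent
  exact hD.map' D.subtype D.ker_subtype
end

section
/- Let W = ℓ²(ℤ; ℂ) with standard orthonormal basis (φ_k)_{k∈ℤ}, and let S be the linear operator with domain Dom(S) = {v ∈ W : ∑_{k∈ℤ} k²|⟨v,φ_k⟩|² < ∞} defined by S v = ∑_{k∈ℤ} i k ⟨v,φ_k⟩ φ_k. Let Z₁ be a complex vector space, D₁ ⊆ Z₁ a subspace, and R₁ : D₁ → Z₁, R₂ : Dom(S) × Dom(S) → Z₁, R₃ : ℂ² → Z₁ linear maps. Let g₁, g₂ ∈ W satisfy ⟨g₁, φ_k⟩ ≠ 0 and ⟨g₂, φ_k⟩ ≠ 0 for all k ∈ ℤ. Set Z = Z₁ × (W × W), define 𝒢₁ on the domain D₁ × (Dom(S) × Dom(S)) by 𝒢₁(z₁, (w₁, w₂)) = (R₁ z₁ + R₂(w₁, w₂), (S w₁, S w₂)), and define 𝒢₂ : ℂ² → Z by 𝒢₂(y₁, y₂) = (R₃(y₁,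 y₂), (y₁ g₁, y₂ g₂)). Then: (a) 𝒢₂ is injective; and (b) for every k ∈ ℤ, ran(ik − 𝒢₁) ∩ ran(𝒢₂) = {0}, where ran(ik − 𝒢₁) = {ik·z − 𝒢₁ z : z ∈ D₁ × (Dom(S) × Dom(S))}. -/
/-- The state space `W = ℓ²(ℤ; ℂ)` of the infinite-dimensional exosystem. -/
noncomputable abbrev Wexo : Type := lp (fun _ : ℤ => ℂ) 2

/-- The domain `Dom(S) = {v ∈ ℓ²(ℤ;ℂ) : ∑_k k² |⟨v,φ_k⟩|² < ∞}` of the diagonal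
exosystem generator `S v = ∑_k i k ⟨v,φ_k⟩ φ_k`, as a subspace of `W = ℓ²(ℤ;ℂ)`. -/
noncomputable def DomS : Submodule ℂ Wexo where
  carrier := {v | Summable fun k : ℤ => (k : ℝ) ^ 2 * ‖v k‖ ^ 2}
  zero_mem' := by
    simp only [Set.mem_setOf_eq, lp.coeFn_zero, Pi.zero_apply, norm_zero]
    simpa using summable_zero
  add_mem' := by
    intro v w hv hw
    simp only [Set.mem_setOf_eq] at hv hw ⊢
    refine Summable.of_nonneg_of_le (fun k => by positivity) (fun k => ?_)
      ((hv.add hw).mul_left 2)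
    have hcoe : (v + w) k = v k + w k := by rw [lp.coeFn_add]; rfl
    rw [hcoe]
    have h2 : ‖v k + w k‖ ^ 2 ≤ 2 * (‖v k‖ ^ 2 + ‖w k‖ ^ 2) := by
      nlinarith [norm_nonneg (v k), norm_nonneg (w k), norm_nonneg (v k + w k),
        norm_add_le (v k) (w k), sq_nonneg (‖v k‖ - ‖w k‖)]
    calc (k : ℝ) ^ 2 * ‖v k + w k‖ ^ 2
        ≤ (k : ℝ) ^ 2 * (2 * (‖v k‖ ^ 2 + ‖w k‖ ^ 2)) :=
          mul_le_mul_of_nonneg_left h2 (sq_nonneg _)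
      _ = 2 * ((k : ℝ) ^ 2 * ‖v k‖ ^ 2 + (k : ℝ) ^ 2 * ‖w k‖ ^ 2) := by ring
  smul_mem' := by
    intro c v hv
    simp only [Set.mem_setOf_eq] at hv ⊢
    refine (hv.mul_left (‖c‖ ^ 2)).congr fun k => ?_
    have hcoe : (c • v) k = c • v k := by rw [lp.coeFn_smul]; rfl
    rw [hcoe, norm_smul]
    ring

/-- The controller `(𝒢₁, 𝒢₂, K)` of Section 9 of the paper, with
`𝒢₁(z₁, (w₁, w₂)) = (R₁ z₁ + R₂ (w₁, w₂), (S w₁, S w₂))` on the domain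
`D₁ × (Dom S × Dom S)` and `𝒢₂(y₁, y₂) = (R₃ (y₁, y₂), (y₁ g₁, y₂ g₂))`, satisfies the
G-conditions: (a) `𝒢₂` is injective, and (b) `ran(ik − 𝒢₁) ∩ ran 𝒢₂ = {0}` for every
`k ∈ ℤ`.  An element of `ran(ik − 𝒢₁)` is described componentwise: its first component is
`ik z₁ − R₁ z₁ − R₂ (w₁, w₂)` and its second component `(b₁, b₂)` satisfies
`b_j(m) = ik w_j(m) − i m w_j(m)` for all `m` (i.e. `b_j = ik w_j − S w_j`). -/
theorem stmt_13 {Z₁ : Type*} [AddCommGroup Z₁] [Module ℂ Z₁]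
    (D₁ : Submodule ℂ Z₁) (R₁ : D₁ →ₗ[ℂ] Z₁)
    (R₂ : (DomS.prod DomS) →ₗ[ℂ] Z₁) (R₃ : (ℂ × ℂ) →ₗ[ℂ] Z₁)
    (g₁ g₂ : Wexo)
    (hg₁ : ∀ k : ℤ, g₁ k ≠ 0) (hg₂ : ∀ k : ℤ, g₂ k ≠ 0) :
    Function.Injective (fun y : ℂ × ℂ =>
      ((R₃ y, (y.1 • g₁, y.2 • g₂)) : Z₁ × (Wexo × Wexo))) ∧
    ∀ k : ℤ, ∀ p : Z₁ × (Wexo × Wexo),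
      (∃ (z₁ : D₁) (w : DomS.prod DomS) (b₁ b₂ : Wexo),
        (∀ m : ℤ, b₁ m =
          (Complex.I * k) * (w : Wexo × Wexo).1 m - (Complex.I * m) * (w : Wexo × Wexo).1 m) ∧
        (∀ m : ℤ, b₂ m =
          (Complex.I * k) * (w : Wexo × Wexo).2 m - (Complex.I * m) * (w : Wexo × Wexo).2 m) ∧
        p = ((Complex.I * k) • ((z₁ : Z₁)) - R₁ z₁ - R₂ w, (b₁, b₂))) →
      (∃ y : ℂ × ℂ, p = (R₃ y, (y.1 • g₁, y.2 • g₂))) →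
      p = 0 := by
  have hsm : ∀ (c : ℂ) (g : Wexo) (m : ℤ), (c • g) m = c * g m := by
    intro c g m
    rw [lp.coeFn_smul]
    rfl
  refine ⟨?_, ?_⟩
  · intro y y' h
    simp only [Prod.mk.injEq] at h
    obtain ⟨-, h1, h2⟩ := h
    have e1 : (y.1 • g₁) 0 = (y'.1 • g₁) 0 := by rw [h1]
    have e2 : (y.2 • g₂) 0 = (y'.2 • g₂) 0 := by rw [h2]
    rw [hsm, hsm] at e1 e2
    exact Prod.ext (mul_right_cancel₀ (hg₁ 0) e1) (mul_right_cancel₀ (hg₂ 0) e2)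
  · rintro k p ⟨z₁, w, b₁, b₂, hb₁, hb₂, hp⟩ ⟨y, hy⟩
    have h := hp.symm.trans hy
    simp only [Prod.mk.injEq] at h
    obtain ⟨-, h1, h2⟩ := h
    have e1 := hb₁ k
    have e2 := hb₂ k
    rw [h1, hsm, sub_self] at e1
    rw [h2, hsm, sub_self] at e2
    have y1 : y.1 = 0 := (mul_eq_zero.mp e1).resolve_right (hg₁ k)
    have y2 : y.2 = 0 := (mul_eq_zero.mp e2).resolve_right (hg₂ k)
    have y0 : y = 0 := Prod.ext y1 y2
    rw [hy, y0]
    simp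
end
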